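/- arXiv:1708.03159 — 2 statements merged into one kernel-verified Lean document; each statement's English description precedes it below -/
import Mathlib

section
/- Let α ∈ (0,1) and b > 0, and let E_α(y) = ∑_{j=0}^∞ y^j / Γ(αj+1) denote the Mittag-Leffler function. Then ∫_0^∞ (1+x)^{-1} |E_α(−x^α / b)| dx < ∞. In particular the measure ν(dx) = α x^{-1} E_α(−x^α/b) dx on (0,∞) satisfies ∫_0^∞ (x/(1+x)) ν(dx) < ∞, so ν is the Lévy measure of a driftless subordinator. -/
open MeasureTheory Real Filter

/-- The Mittag-Leffler function `E_α(y) = ∑_{j=0}^∞ y^j / Γ(αj+1)`. -/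
noncomputable def mittagLeffler (α y : ℝ) : ℝ :=
  ∑' j : ℕ, y ^ j / Real.Gamma (α * j + 1)

/-- Markov-type lower bound for the Gamma function. -/
theorem exp_neg_mul_rpow_le_Gamma_add_one {R x : ℝ} (hR : 0 < R) (hx : 0 ≤ x) :
    exp (-R) * R ^ x ≤ Gamma (x + 1) := by
  have hint := GammaIntegral_convergent (s := x + 1) (by linarith)
  rw [Gamma_eq_integral (by linarith)]
  have hsub : Set.Ioi R ⊆ Set.Ioi 0 := Set.Ioi_subset_Ioi hR.le
  calc exp (-R) * R ^ x = ∫ t in Set.Ioi R, exp (-t) * R ^ x := by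
        rw [integral_mul_const, integral_exp_neg_Ioi]
    _ ≤ ∫ t in Set.Ioi R, exp (-t) * t ^ (x + 1 - 1) := by
        refine setIntegral_mono_on ?_ (hint.mono_set hsub) measurableSet_Ioi fun t ht => ?_
        · exact (integrableOn_exp_neg_Ioi R).mul_const _
        · rw [add_sub_cancel_right]
          have : R ≤ t := le_of_lt ht
          gcongr
    _ ≤ ∫ t in Set.Ioi 0, exp (-t) * t ^ (x + 1 - 1) := by
        refine setIntegral_mono_set hint ?_ hsub.eventuallyLE
        filter_upwards [ae_restrict_mem measurableSet_Ioi] with t ht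
        have : (0 : ℝ) < t := ht
        positivity

theorem summable_pow_div_Gamma {a : ℝ} (ha : 0 < a) {r : ℝ} (hr : 0 ≤ r) :
    Summable fun j : ℕ => r ^ j / Gamma (a * j + 1) := by
  set R : ℝ := (2 * r + 1) ^ a⁻¹ with hRdef
  have hR : 0 < R := by positivity
  have hRa : R ^ a = 2 * r + 1 := by
    rw [hRdef, ← rpow_mul (by positivity), inv_mul_cancel₀ ha.ne', rpow_one]
  have hq : r / (2 * r + 1) < 1 := by rw [div_lt_one (by positivity)]; linarith
  refine Summable.of_nonneg_of_le (fun j => ?_) (fun j => ?_)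
    ((summable_geometric_of_lt_one (by positivity) hq).mul_left (exp R))
  · have := Gamma_pos_of_pos (s := a * j + 1) (by positivity)
    positivity
  · have h := exp_neg_mul_rpow_le_Gamma_add_one hR (x := a * j) (by positivity)
    rw [rpow_mul hR.le, hRa, rpow_natCast] at h
    calc r ^ j / Gamma (a * j + 1) ≤ r ^ j / (exp (-R) * (2 * r + 1) ^ j) := by gcongr
      _ = exp R * (r / (2 * r + 1)) ^ j := by
        rw [exp_neg, div_pow]
        field_simp

theorem continuous_mittagLeffler {a : ℝ} (ha : 0 < a) : Continuous (mittagLeffler a) := by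
  rw [continuous_iff_continuousAt]
  intro y
  have hc : ContinuousOn (mittagLeffler a) (Metric.ball 0 (|y| + 1)) := by
    refine continuousOn_tsum (fun j => by fun_prop)
      (summable_pow_div_Gamma ha (r := |y| + 1) (by positivity)) fun j x hx => ?_
    have hx' : |x| ≤ |y| + 1 := by simpa using (Metric.mem_ball.1 hx).le
    have hG := Gamma_pos_of_pos (s := a * j + 1) (by positivity)
    rw [norm_div, norm_pow, Real.norm_eq_abs, Real.norm_eq_abs, abs_of_pos hG]
    gcongr
  exact hc.continuousAt (Metric.isOpen_ball.mem_nhds (by simp))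

/-- The beta integral over `[0, t]`. -/
theorem integral_rpow_mul_sub_rpow {p q t : ℝ} (hp : 0 < p) (hq : 0 < q) (ht : 0 < t) :
    ∫ s in (0 : ℝ)..t, s ^ (p - 1) * (t - s) ^ (q - 1)
      = t ^ (p + q - 1) * (Gamma p * Gamma q / Gamma (p + q)) := by
  have h := Complex.betaIntegral_scaled p q ht
  rw [Complex.betaIntegral_eq_Gamma_mul_div _ _ (by simpa) (by simpa)] at h
  apply Complex.ofReal_injective
  rw [← intervalIntegral.integral_ofReal]
  push_cast [Complex.ofReal_cpow ht.le, ← Complex.Gamma_ofReal]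
  rw [← h]
  refine intervalIntegral.integral_congr fun s hs => ?_
  rw [Set.uIcc_of_le ht.le] at hs
  rw [Complex.ofReal_cpow hs.1, Complex.ofReal_cpow (sub_nonneg.2 hs.2)]
  push_cast
  rfl

theorem intervalIntegrable_sub_rpow {a : ℝ} (ha : 0 < a) (t x y : ℝ) :
    IntervalIntegrable (fun s : ℝ => (t - s) ^ (a - 1)) volume x y := by
  have h := (intervalIntegral.intervalIntegrable_rpow' (a := t - x) (b := t - y)
    (r := a - 1) (by linarith)).comp_sub_left t
  simpa using h

/-- `t ↦ E_a(-c t^a)` solves a linear Abel integral equation of the second kind. -/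
theorem mittagLeffler_volterra {a b t : ℝ} (ha : 0 < a) (hb : 0 < b) (ht : 0 < t) :
    mittagLeffler a (-(t ^ a) / b) = 1 - (b * Gamma a)⁻¹ *
      ∫ s in (0 : ℝ)..t, (t - s) ^ (a - 1) * mittagLeffler a (-(s ^ a) / b) := by
  have hGa := Gamma_pos_of_pos ha
  have hG (j : ℕ) : 0 < Gamma (a * j + 1) := Gamma_pos_of_pos (by positivity)
  have hG' (j : ℕ) : 0 < Gamma (a * (j + 1 : ℕ) + 1) := Gamma_pos_of_pos (by positivity)
  set F : ℕ → ℝ → ℝ := fun j s =>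
    (t - s) ^ (a - 1) * ((-(s ^ a) / b) ^ j / Gamma (a * j + 1)) with hF
  have hFint (j : ℕ) : IntervalIntegrable (F j) volume 0 t := by
    refine (intervalIntegrable_sub_rpow ha t 0 t).mul_continuousOn (Continuous.continuousOn ?_)
    have := Real.continuous_rpow_const (q := a) ha.le
    fun_prop
  have hFeq (j : ℕ) (s : ℝ) (hs : 0 ≤ s) : F j s =
      ((-1 / b) ^ j / Gamma (a * j + 1)) * (s ^ (a * j + 1 - 1) * (t - s) ^ (a - 1)) := by
    simp only [hF]
    rw [add_sub_cancel_right, rpow_mul hs, rpow_natCast,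
      show -(s ^ a) / b = (-1 / b) * s ^ a by ring, mul_pow]
    ring
  have hval (j : ℕ) : t ^ (a * j + 1 + a - 1) *
      (Gamma (a * j + 1) * Gamma a / Gamma (a * j + 1 + a)) =
      Gamma (a * j + 1) * Gamma a * ((t ^ a) ^ (j + 1) / Gamma (a * (j + 1 : ℕ) + 1)) := by
    rw [show a * j + 1 + a - 1 = a * (j + 1 : ℕ) by push_cast; ring,
      show a * j + 1 + a = a * (j + 1 : ℕ) + 1 by push_cast; ring, rpow_mul ht.le, rpow_natCast]
    ring
  have hI (j : ℕ) : ∫ s in (0 : ℝ)..t, F j s =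
      -(b * Gamma a) * ((-(t ^ a) / b) ^ (j + 1) / Gamma (a * (j + 1 : ℕ) + 1)) := by
    rw [intervalIntegral.integral_congr (g := fun s => ((-1 / b) ^ j / Gamma (a * j + 1)) *
      (s ^ (a * j + 1 - 1) * (t - s) ^ (a - 1))), intervalIntegral.integral_const_mul,
      integral_rpow_mul_sub_rpow (by positivity) ha ht, hval,
      show -(t ^ a) / b = (-1 / b) * t ^ a by ring, mul_pow _ _ (j + 1), pow_succ (-1 / b) j]
    · have := (hG j).ne'
      have := (hG' j).ne'
      field_simp
    · intro s hs
      rw [Set.uIcc_of_le ht.le] at hs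
      exact hFeq j s hs.1
  have hN (j : ℕ) : ∫ s in Set.Ioc 0 t, ‖F j s‖ =
      (b * Gamma a) * ((t ^ a / b) ^ (j + 1) / Gamma (a * (j + 1 : ℕ) + 1)) := by
    rw [← intervalIntegral.integral_of_le ht.le,
      intervalIntegral.integral_congr (g := fun s => ((1 / b) ^ j / Gamma (a * j + 1)) *
      (s ^ (a * j + 1 - 1) * (t - s) ^ (a - 1))), intervalIntegral.integral_const_mul,
      integral_rpow_mul_sub_rpow (by positivity) ha ht, hval,
      show t ^ a / b = (1 / b) * t ^ a by ring, mul_pow _ _ (j + 1), pow_succ (1 / b) j]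
    · have := (hG j).ne'
      have := (hG' j).ne'
      field_simp
    · intro s hs
      rw [Set.uIcc_of_le ht.le] at hs
      have h1 : 0 ≤ s ^ (a * j + 1 - 1) * (t - s) ^ (a - 1) :=
        mul_nonneg (rpow_nonneg hs.1 _) (rpow_nonneg (sub_nonneg.2 hs.2) _)
      simp only
      rw [hFeq j s hs.1, norm_mul, norm_div, norm_pow, norm_div, norm_neg, norm_one,
        Real.norm_of_nonneg hb.le, Real.norm_of_nonneg (hG j).le, Real.norm_of_nonneg h1]
  have hsum := hasSum_integral_of_summable_integral_norm (μ := volume.restrict (Set.Ioc 0 t))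
    (F := F) (fun j => (intervalIntegrable_iff_integrableOn_Ioc_of_le ht.le).1 (hFint j)) (by
      simp_rw [hN]
      exact ((summable_nat_add_iff 1).2
        (summable_pow_div_Gamma ha (r := t ^ a / b) (by positivity))).mul_left _)
  simp_rw [← intervalIntegral.integral_of_le ht.le, hI] at hsum
  have hs : Summable fun j : ℕ => (-(t ^ a) / b) ^ j / Gamma (a * j + 1) := by
    refine Summable.of_norm ((summable_pow_div_Gamma ha (r := t ^ a / b) (by positivity)).congr
      fun j => ?_)
    rw [norm_div, norm_pow, norm_div, norm_neg, Real.norm_of_nonneg hb.le,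
      Real.norm_of_nonneg (hG j).le, Real.norm_of_nonneg (rpow_nonneg ht.le a)]
  have hint : ∫ s in (0 : ℝ)..t, ∑' j, F j s =
      ∫ s in (0 : ℝ)..t, (t - s) ^ (a - 1) * mittagLeffler a (-(s ^ a) / b) := by
    simp only [hF, mittagLeffler, tsum_mul_left]
  rw [← hint, ← hsum.tsum_eq, tsum_mul_left, mittagLeffler, hs.tsum_eq_zero_add]
  simp only [pow_zero, Nat.cast_zero, mul_zero, zero_add, Gamma_one, div_one]
  field_simp
  ring

section AbelEquation

variable {u : ℝ → ℝ} {a c : ℝ}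

theorem integral_sub_rpow {t x : ℝ} (ha : 0 < a) :
    ∫ s in x..t, (t - s) ^ (a - 1) = (t - x) ^ a / a := by
  rw [intervalIntegral.integral_comp_sub_left (fun s => s ^ (a - 1)) t,
    integral_rpow (Or.inl (by linarith))]
  simp [zero_rpow ha.ne']

theorem intervalIntegrable_sub_rpow_mul (ha : 0 < a) (hu : Continuous u) (t x y : ℝ) :
    IntervalIntegrable (fun s : ℝ => (t - s) ^ (a - 1) * u s) volume x y :=
  (intervalIntegrable_sub_rpow ha t x y).mul_continuousOn hu.continuousOn

theorem pos_of_abel_equation (ha : 0 < a) (ha1 : a < 1) (hc : 0 < c) (hu : Continuous u)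
    (hu0 : u 0 = 1)
    (h : ∀ t, 0 < t → u t = 1 - c * ∫ s in (0 : ℝ)..t, (t - s) ^ (a - 1) * u s)
    {t : ℝ} (ht : 0 ≤ t) : 0 < u t := by
  by_contra! hneg
  have hclosed : IsClosed {s : ℝ | u s ≤ 0} := isClosed_le hu continuous_const
  have hK : IsCompact (Set.Icc 0 t ∩ {s : ℝ | u s ≤ 0}) := isCompact_Icc.inter_right hclosed
  obtain ⟨z, ⟨⟨hz0, hzt⟩, huz⟩, hzmin⟩ := hK.exists_isLeast ⟨t, ⟨ht, le_rfl⟩, hneg⟩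
  simp only [Set.mem_ofPred_eq] at huz
  have hzpos : 0 < z := hz0.lt_of_ne (by rintro rfl; linarith)
  have hpos : ∀ s, 0 ≤ s → s < z → 0 < u s := fun s hs hsz => by
    by_contra! hsn
    exact absurd (hzmin ⟨⟨hs, hsz.le.trans hzt⟩, hsn⟩) (not_le.2 hsz)
  have hlim : Tendsto (fun x : ℝ => c * ((z - x) ^ a / a)) (nhds z) (nhds 0) := by
    have hcont : Continuous fun x : ℝ => c * ((z - x) ^ a / a) := by
      have := Real.continuous_rpow_const (q := a) ha.le
      fun_prop
    have := hcont.tendsto z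
    simpa [zero_rpow ha.ne'] using this
  have hev := (hlim.eventually (gt_mem_nhds zero_lt_one)).and (lt_mem_nhds hzpos)
  obtain ⟨x, ⟨hx1, hx0⟩, hxz⟩ :=
    ((hev.filter_mono nhdsWithin_le_nhds).and (self_mem_nhdsWithin (s := Set.Iio z))).exists
  obtain ⟨y, ⟨hxy, hyz⟩, hymax⟩ :=
    isCompact_Icc.exists_isMaxOn (Set.nonempty_Icc.2 hxz.le) hu.continuousOn
  have huy : 0 < u y := (hpos x hx0.le hxz).trans_le (hymax ⟨le_rfl, hxz.le⟩)
  have hyz' : y < z := hyz.lt_of_ne (by rintro rfl; linarith)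
  have hy0 : 0 < y := hx0.trans_le hxy
  have hI := intervalIntegrable_sub_rpow_mul ha hu
  have hsplit := intervalIntegral.integral_add_adjacent_intervals (hI z 0 y) (hI z y z)
  have hmono : ∫ s in (0 : ℝ)..y, (z - s) ^ (a - 1) * u s ≤
      ∫ s in (0 : ℝ)..y, (y - s) ^ (a - 1) * u s := by
    refine intervalIntegral.integral_mono_on_of_le_Ioo hy0.le (hI z 0 y) (hI y 0 y)
      fun s hs => ?_
    refine mul_le_mul_of_nonneg_right ?_ (hpos s hs.1.le (hs.2.trans hyz')).le
    exact rpow_le_rpow_of_nonpos (sub_pos.2 hs.2) (by linarith) (by linarith)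
  have htail : ∫ s in y..z, (z - s) ^ (a - 1) * u s ≤ (z - x) ^ a / a * u y := by
    calc ∫ s in y..z, (z - s) ^ (a - 1) * u s ≤ ∫ s in y..z, (z - s) ^ (a - 1) * u y := by
          refine intervalIntegral.integral_mono_on_of_le_Ioo hyz (hI z y z)
            ((intervalIntegrable_sub_rpow ha z y z).mul_const _) fun s hs => ?_
          exact mul_le_mul_of_nonneg_left (hymax ⟨hxy.trans hs.1.le, hs.2.le⟩)
            (rpow_nonneg (sub_nonneg.2 hs.2.le) _)
      _ = (z - y) ^ a / a * u y := by
          rw [intervalIntegral.integral_mul_const, integral_sub_rpow ha]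
      _ ≤ (z - x) ^ a / a * u y := by
          have : 0 ≤ z - y := sub_nonneg.2 hyz
          gcongr
  have hz := h z hzpos
  have hy := h y hy0
  rw [← hsplit] at hz
  have h1 := mul_le_mul_of_nonneg_left hmono hc.le
  have h2 := mul_le_mul_of_nonneg_left htail hc.le
  have h3 := mul_lt_mul_of_pos_right hx1 huy
  nlinarith

theorem integral_le_of_abel_equation (ha : 0 < a) (ha1 : a < 1) (hc : 0 < c) (hu : Continuous u)
    (hu0 : u 0 = 1)
    (h : ∀ t, 0 < t → u t = 1 - c * ∫ s in (0 : ℝ)..t, (t - s) ^ (a - 1) * u s)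
    {t : ℝ} (ht : 0 < t) : ∫ s in (0 : ℝ)..t, u s ≤ c⁻¹ * t ^ (1 - a) := by
  have hpos : ∀ s, 0 ≤ s → 0 < u s := fun s hs => pos_of_abel_equation ha ha1 hc hu hu0 h hs
  have hmono : ∫ s in (0 : ℝ)..t, t ^ (a - 1) * u s ≤
      ∫ s in (0 : ℝ)..t, (t - s) ^ (a - 1) * u s := by
    refine intervalIntegral.integral_mono_on_of_le_Ioo ht.le
      ((hu.intervalIntegrable 0 t).const_mul _)
      (intervalIntegrable_sub_rpow_mul ha hu t 0 t) fun s hs => ?_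
    refine mul_le_mul_of_nonneg_right ?_ (hpos s hs.1.le).le
    exact rpow_le_rpow_of_nonpos (sub_pos.2 hs.2) (by linarith [hs.1]) (by linarith)
  rw [intervalIntegral.integral_const_mul] at hmono
  have h1 := mul_le_mul_of_nonneg_left hmono hc.le
  have h2 : c * (t ^ (a - 1) * ∫ s in (0 : ℝ)..t, u s) ≤ 1 := by
    linarith [h t ht, hpos t ht.le]
  have h3 : t ^ (1 - a) = (t ^ (a - 1))⁻¹ := by rw [← rpow_neg ht.le]; ring_nf
  have h4 : 0 < t ^ (a - 1) := rpow_pos_of_pos ht _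
  rw [h3, ← mul_inv, ← one_div, le_div_iff₀ (by positivity)]
  linarith

theorem integrableOn_inv_one_add_mul (ha : 0 < a) (ha1 : a < 1) {C : ℝ} (hC : 0 ≤ C)
    (hu : Continuous u) (hpos : ∀ s, 0 ≤ s → 0 ≤ u s)
    (hU : ∀ t, 0 < t → ∫ s in (0 : ℝ)..t, u s ≤ C * t ^ (1 - a)) :
    IntegrableOn (fun x : ℝ => (1 + x)⁻¹ * u x) (Set.Ioi 0) volume := by
  have hcont : ContinuousOn (fun x : ℝ => (1 + x)⁻¹ * u x) (Set.Ioi (-1)) := by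
    refine ContinuousOn.mul (ContinuousOn.inv₀ (by fun_prop) fun x hx => ?_) hu.continuousOn
    have : -1 < x := hx
    linarith
  have hint (T : ℝ) (hT : 0 ≤ T) :
      IntervalIntegrable (fun x : ℝ => (1 + x)⁻¹ * u x) volume 0 T := by
    refine (hcont.mono fun x hx => ?_).intervalIntegrable
    rw [Set.uIcc_of_le hT] at hx
    exact lt_of_lt_of_le (by norm_num) hx.1
  set U : ℝ → ℝ := fun t => ∫ s in (0 : ℝ)..t, u s with hUdef
  set F : ℝ → ℝ := fun t => ∫ s in (0 : ℝ)..t, (1 + s)⁻¹ * u s with hFdef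
  set G : ℝ → ℝ := fun t => F t - (1 + t)⁻¹ * U t + C / a * (1 + t) ^ (-a) with hGdef
  have hG (t : ℝ) (ht : 0 ≤ t) :
      HasDerivAt G (((1 + t) ^ 2)⁻¹ * U t - C * (1 + t) ^ (-a - 1)) t := by
    have h0 : (1 + t) ≠ 0 := by positivity
    have hF' : HasDerivAt F ((1 + t)⁻¹ * u t) t := by
      have hmem : Set.Ioi (-1 : ℝ) ∈ nhds t := Ioi_mem_nhds (by linarith)
      exact intervalIntegral.integral_hasDerivAt_right (hint t ht)
        (hcont.stronglyMeasurableAtFilter isOpen_Ioi t (by simp; linarith))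
        (hcont.continuousAt hmem)
    have hU' : HasDerivAt U (u t) t := intervalIntegral.integral_hasDerivAt_right
      (hu.intervalIntegrable 0 t) (hu.stronglyMeasurableAtFilter _ _) hu.continuousAt
    have h1 : HasDerivAt (fun t : ℝ => 1 + t) 1 t := (hasDerivAt_id t).const_add 1
    have h2 := h1.inv h0
    have h3 := (h1.rpow_const (p := -a) (Or.inl h0)).const_mul (C / a)
    convert! (hF'.sub (h2.mul hU')).add h3 using 1
    simp only [Pi.inv_apply]
    field_simp
    ring
  have hanti : AntitoneOn G (Set.Ici 0) := by
    refine antitoneOn_of_deriv_nonpos (convex_Ici 0)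
      (fun t ht => (hG t ht).continuousAt.continuousWithinAt)
      (fun t ht => (hG t (interior_subset ht)).differentiableAt.differentiableWithinAt)
      fun t ht => ?_
    rw [interior_Ici] at ht
    have ht0 : 0 < t := ht
    rw [(hG t ht0.le).deriv, sub_nonpos]
    calc ((1 + t) ^ 2)⁻¹ * U t ≤ ((1 + t) ^ 2)⁻¹ * (C * (1 + t) ^ (1 - a)) := by
          refine mul_le_mul_of_nonneg_left ((hU t ht0).trans ?_) (by positivity)
          have : 0 ≤ 1 - a := by linarith
          gcongr
          linarith
      _ = C * (1 + t) ^ (-a - 1) := by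
          rw [show -a - 1 = (1 - a) - (2 : ℕ) by push_cast; ring,
            rpow_sub_natCast (by positivity)]
          ring
  have hbound (T : ℝ) (hT : 0 < T) : F T ≤ C / a + C := by
    have h1 := hanti (Set.mem_Ici.2 le_rfl) (Set.mem_Ici.2 hT.le) hT.le
    have h2 : G 0 = C / a := by simp [hGdef, hFdef, hUdef]
    have h3 : 0 ≤ C / a * (1 + T) ^ (-a) := by positivity
    have h4 : (1 + T)⁻¹ * U T ≤ C := by
      rw [inv_mul_le_iff₀ (by positivity)]
      calc U T ≤ C * T ^ (1 - a) := hU T hT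
        _ ≤ C * (1 + T) ^ (1 : ℝ) := by
            refine mul_le_mul_of_nonneg_left ?_ hC
            exact (rpow_le_rpow hT.le (by linarith) (by linarith)).trans
              (rpow_le_rpow_of_exponent_le (by linarith) (by linarith))
        _ = (1 + T) * C := by rw [rpow_one, mul_comm]
    rw [h2] at h1
    simp only [hGdef] at h1
    linarith
  refine integrableOn_Ioi_of_intervalIntegral_norm_bounded (C / a + C) 0 (l := atTop)
    (b := fun n : ℕ => (n : ℝ)) (fun n => ?_) tendsto_natCast_atTop_atTop ?_
  · exact (intervalIntegrable_iff_integrableOn_Ioc_of_le (by positivity)).1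
      (hint n (by positivity))
  · filter_upwards [eventually_gt_atTop 0] with n hn
    have hn' : (0 : ℝ) < n := by exact_mod_cast hn
    refine le_trans (le_of_eq ?_) (hbound n hn')
    refine intervalIntegral.integral_congr fun x hx => ?_
    rw [Set.uIcc_of_le hn'.le] at hx
    exact Real.norm_of_nonneg (mul_nonneg (inv_nonneg.2 (by linarith [hx.1])) (hpos x hx.1))

end AbelEquation

theorem stmt11 (α b : ℝ) (hα : α ∈ Set.Ioo (0 : ℝ) 1) (hb : 0 < b) :
    IntegrableOn (fun x : ℝ => (1 + x)⁻¹ * |mittagLeffler α (-(x ^ α) / b)|)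
      (Set.Ioi 0) volume ∧
    IntegrableOn (fun x : ℝ =>
      (x / (1 + x)) * (α * x⁻¹ * mittagLeffler α (-(x ^ α) / b)))
      (Set.Ioi 0) volume := by
  obtain ⟨ha, ha1⟩ := hα
  have hc : 0 < (b * Gamma α)⁻¹ := by
    have := Gamma_pos_of_pos ha
    positivity
  have hu : Continuous fun x : ℝ => mittagLeffler α (-(x ^ α) / b) := by
    have h1 := continuous_mittagLeffler ha
    have h2 := Real.continuous_rpow_const (q := α) ha.le
    fun_prop
  have hu0 : mittagLeffler α (-((0 : ℝ) ^ α) / b) = 1 := by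
    rw [zero_rpow ha.ne', neg_zero, zero_div, mittagLeffler, tsum_eq_single 0]
    · simp
    · intro j hj
      simp [hj]
  have hV := fun (t : ℝ) (ht : 0 < t) => mittagLeffler_volterra (b := b) ha hb ht
  have hpos := fun (s : ℝ) (hs : 0 ≤ s) => pos_of_abel_equation ha ha1 hc hu hu0 hV hs
  have key := integrableOn_inv_one_add_mul ha ha1 (inv_nonneg.2 hc.le) hu
    (fun s hs => (hpos s hs).le)
    (fun t ht => integral_le_of_abel_equation ha ha1 hc hu hu0 hV ht)
  constructor
  · refine key.congr_fun (fun x hx => ?_) measurableSet_Ioi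
    simp only [abs_of_pos (hpos x (le_of_lt hx))]
  · refine IntegrableOn.congr_fun (key.const_mul α) (fun x hx => ?_) measurableSet_Ioi
    have hx0 : (0 : ℝ) < x := hx
    have : 1 + x ≠ 0 := by positivity
    field_simp
end

section
/- Let α ∈ (0,2] with α ≠ 1, θ ∈ ℝ with |θ| ≤ min{α, 2−α}, b : [0,∞) → (0,∞) continuous, s ≥ 0 and f ∈ 𝒮(ℝ). For t ≥ s and x ∈ ℝ define u(x,t) = (2π)^{-1/2} ∫_ℝ e^{iξx} exp( −∫_s^t Log(1 + b(τ) ψ_{α,θ}(ξ)) dτ ) f̂(ξ) dξ. Then u(x,s) = f(x) for all x, and for every x and t ≥ s the function t ↦ u(x,t) is differentiable with ∂_t u(x,t) = (2π)^{-1/2} ∫_ℝ e^{iξx} ( −Log(1 + b(t) ψ_{α,θ}(ξ)) ) exp( −∫_s^t Log(1 + b(τ) ψ_{α,θ}(ξ)) dτ ) f̂(ξ) dξ; that is, u solves the initial value problem ∂_t u = 𝒫_{b(t)}^{α,θ} u, u(·,s) = f, for the Fourier-multiplier operator 𝒫_{b(t)}^{α,θ} with symbol −Log(1 + b(t) ψ_{α,θ}(ξ)).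 -/
open MeasureTheory Complex Real Filter

/-- Fourier transform with the `(2π)^{-1/2}` normalization. -/
noncomputable def fhat (f : ℝ → ℂ) (p : ℝ) : ℂ :=
  (Real.sqrt (2 * Real.pi))⁻¹ * ∫ x : ℝ, Complex.exp (-(Complex.I * p * x)) * f x

/-- Feller symbol `ψ_{α,θ}(ξ) = |ξ|^α e^{i sign(ξ) θ π / 2}` of the α-stable process. -/
noncomputable def feller (α θ ξ : ℝ) : ℂ :=
  ((|ξ| ^ α : ℝ) : ℂ) * Complex.exp (Complex.I * Real.sign ξ * θ * Real.pi / 2)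

theorem norm_log_one_add_mul_le {w : ℂ} (hw : 0 ≤ w.re) {β B N : ℝ} (hβ : 0 < β) (hB : β ≤ B)
    (hN : ‖w‖ ≤ N) : ‖Complex.log (1 + (β : ℂ) * w)‖ ≤ Real.pi + B * N ∧
      0 ≤ (Complex.log (1 + (β : ℂ) * w)).re ∧
      (Complex.log (1 + (β : ℂ) * w)).re ≤ Real.log (1 + B * N) := by
  have hN0 : 0 ≤ N := (norm_nonneg _).trans hN
  have hre : 1 ≤ (1 + (β : ℂ) * w).re := by
    simp only [Complex.add_re, Complex.one_re, Complex.re_ofReal_mul]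
    nlinarith [mul_nonneg hβ.le hw]
  have h1 : 1 ≤ ‖1 + (β : ℂ) * w‖ := hre.trans (Complex.re_le_norm _)
  have h2 : ‖1 + (β : ℂ) * w‖ ≤ 1 + B * N := by
    refine (norm_add_le _ _).trans ?_
    have hB0 : 0 ≤ B := hβ.le.trans hB
    rw [norm_one, norm_mul, Complex.norm_real, Real.norm_of_nonneg hβ.le]
    gcongr
  have hlog : Real.log ‖1 + (β : ℂ) * w‖ ≤ Real.log (1 + B * N) :=
    Real.log_le_log (by linarith) h2
  rw [Complex.log_re]
  refine ⟨?_, Real.log_nonneg h1, hlog⟩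
  refine (Complex.norm_le_abs_re_add_abs_im _).trans ?_
  rw [Complex.log_re, Complex.log_im, abs_of_nonneg (Real.log_nonneg h1), add_comm]
  refine add_le_add (Complex.abs_arg_le_pi _) (hlog.trans ?_)
  have := Real.log_le_sub_one_of_pos (x := 1 + B * N) (by linarith)
  linarith

theorem one_add_mul_mem_slitPlane {w : ℂ} (hw : 0 ≤ w.re) {β : ℝ} (hβ : 0 < β) :
    1 + (β : ℂ) * w ∈ Complex.slitPlane := by
  left
  simp only [Complex.add_re, Complex.one_re, Complex.re_ofReal_mul]
  nlinarith [mul_nonneg hβ.le hw]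

theorem continuousAt_log_one_add_mul {b : ℝ → ℝ} (hb : Continuous b) {w : ℂ} (hw : 0 ≤ w.re)
    {τ : ℝ} (hτ : 0 < b τ) :
    ContinuousAt (fun τ => Complex.log (1 + (b τ : ℂ) * w)) τ :=
  ContinuousAt.clog (by fun_prop) (one_add_mul_mem_slitPlane hw hτ)

theorem intervalIntegrable_log_one_add_mul {b : ℝ → ℝ} (hb : Continuous b) {w : ℂ}
    (hw : 0 ≤ w.re) {s t : ℝ} (h : ∀ τ ∈ Set.uIcc s t, 0 < b τ) :
    IntervalIntegrable (fun τ => Complex.log (1 + (b τ : ℂ) * w)) volume s t :=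
  ContinuousOn.intervalIntegrable fun τ hτ =>
    (continuousAt_log_one_add_mul hb hw (h τ hτ)).continuousWithinAt

theorem norm_exp_neg_integral_log_le {b : ℝ → ℝ} (hb : Continuous b) {w : ℂ} (hw : 0 ≤ w.re)
    {s t B N : ℝ} (h : ∀ τ ∈ Set.uIcc s t, 0 < b τ ∧ b τ ≤ B) (hN : ‖w‖ ≤ N) (hst : s - 1 ≤ t) :
    ‖Complex.exp (-(∫ τ in s..t, Complex.log (1 + (b τ : ℂ) * w)))‖ ≤ 1 + B * N := by
  have hB : 0 ≤ B := by
    have := h s Set.left_mem_uIcc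
    linarith
  have hN0 : 0 ≤ N := (norm_nonneg _).trans hN
  have hBN : 0 ≤ B * N := mul_nonneg hB hN0
  have hint := intervalIntegrable_log_one_add_mul hb hw fun τ hτ => (h τ hτ).1
  have hre : (∫ τ in s..t, Complex.log (1 + (b τ : ℂ) * w)).re =
      ∫ τ in s..t, (Complex.log (1 + (b τ : ℂ) * w)).re :=
    (Complex.reCLM.intervalIntegral_comp_comm hint).symm
  have hint' : IntervalIntegrable (fun τ => (Complex.log (1 + (b τ : ℂ) * w)).re) volume s t :=
    ContinuousOn.intervalIntegrable fun τ hτ => (Complex.continuous_re.continuousAt.comp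
      (continuousAt_log_one_add_mul hb hw (h τ hτ).1)).continuousWithinAt
  have hbd : ∀ τ ∈ Set.uIcc s t, 0 ≤ (Complex.log (1 + (b τ : ℂ) * w)).re ∧
      (Complex.log (1 + (b τ : ℂ) * w)).re ≤ Real.log (1 + B * N) := fun τ hτ =>
    (norm_log_one_add_mul_le hw (h τ hτ).1 (h τ hτ).2 hN).2
  have hL : 0 ≤ Real.log (1 + B * N) := Real.log_nonneg (by linarith)
  rw [Complex.norm_exp, Complex.neg_re, hre, ← Real.le_log_iff_exp_le (by linarith)]
  rcases le_total s t with hle | hle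
  · rw [Set.uIcc_of_le hle] at hbd
    have := intervalIntegral.integral_nonneg (μ := volume) hle fun τ hτ => (hbd τ hτ).1
    linarith
  · rw [Set.uIcc_of_ge hle] at hbd
    rw [intervalIntegral.integral_symm, neg_neg]
    calc ∫ τ in t..s, (Complex.log (1 + (b τ : ℂ) * w)).re
        ≤ ∫ _ in t..s, Real.log (1 + B * N) :=
          intervalIntegral.integral_mono_on hle hint'.symm intervalIntegrable_const
            fun τ hτ => (hbd τ hτ).2
      _ = (s - t) * Real.log (1 + B * N) := by
          rw [intervalIntegral.integral_const, smul_eq_mul]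
      _ ≤ Real.log (1 + B * N) := by nlinarith

theorem stronglyMeasurable_intervalIntegral_log {b : ℝ → ℝ} (hb : Continuous b) {ψ : ℝ → ℂ}
    (hψ : Measurable ψ) (s t : ℝ) :
    StronglyMeasurable fun ξ => ∫ τ in s..t, Complex.log (1 + (b τ : ℂ) * ψ ξ) := by
  have hm : StronglyMeasurable
      (Function.uncurry fun ξ τ : ℝ => Complex.log (1 + (b τ : ℂ) * ψ ξ)) := by
    refine Measurable.stronglyMeasurable (Complex.measurable_log.comp ?_)
    have := hb.measurable
    fun_prop
  unfold intervalIntegral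
  exact hm.integral_prod_right.sub hm.integral_prod_right

/-- Differentiation under the integral sign for Fourier integrals whose symbol solves
`∂ₜ E = -Log (1 + b(t) ψ) E`, with `ψ` of at most quadratic growth and `Re ψ ≥ 0`. -/
theorem hasDerivAt_integral_exp_neg_integral_log {b : ℝ → ℝ} (hb : Continuous b) {ψ : ℝ → ℂ}
    (hψ : Measurable ψ) (hre : ∀ ξ, 0 ≤ (ψ ξ).re) (hgrowth : ∀ ξ, ‖ψ ξ‖ ≤ 1 + ξ ^ 2)
    {g : ℝ → ℂ} (hg : ∀ k : ℕ, Integrable fun ξ : ℝ => ‖ξ‖ ^ k * ‖g ξ‖)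
    (hgm : AEStronglyMeasurable g) {a T B s t : ℝ}
    (hab : ∀ τ ∈ Set.Icc a T, 0 < b τ ∧ b τ ≤ B) (hs : s ∈ Set.Icc a T) (hsa : s - 1 ≤ a)
    (ht : t ∈ Set.Ioo a T) (x : ℝ) :
    HasDerivAt (fun t' : ℝ => ∫ ξ : ℝ, Complex.exp (Complex.I * ξ * x) *
        (Complex.exp (-(∫ τ in s..t', Complex.log (1 + (b τ : ℂ) * ψ ξ))) * g ξ))
      (∫ ξ : ℝ, Complex.exp (Complex.I * ξ * x) *
        ((-Complex.log (1 + (b t : ℂ) * ψ ξ)) *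
          (Complex.exp (-(∫ τ in s..t, Complex.log (1 + (b τ : ℂ) * ψ ξ))) * g ξ))) t := by
  have hsub : ∀ t' ∈ Set.Ioo a T, ∀ τ ∈ Set.uIcc s t', 0 < b τ ∧ b τ ≤ B := fun t' ht' τ hτ =>
    hab τ (Set.uIcc_subset_Icc hs (Set.Ioo_subset_Icc_self ht') hτ)
  have hB : 0 ≤ B := by
    have := hab s hs
    linarith
  have hx : ∀ ξ : ℝ, ‖Complex.exp (Complex.I * ξ * x)‖ = 1 := fun ξ => by
    rw [Complex.norm_exp]; simp
  have hexp : ∀ t' ∈ Set.Ioo a T, ∀ ξ : ℝ,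
      ‖Complex.exp (-(∫ τ in s..t', Complex.log (1 + (b τ : ℂ) * ψ ξ)))‖ ≤
        1 + B * (1 + ξ ^ 2) := fun t' ht' ξ =>
    norm_exp_neg_integral_log_le hb (hre ξ) (hsub t' ht') (hgrowth ξ) (hsa.trans ht'.1.le)
  have hmeas : ∀ t', AEStronglyMeasurable (fun ξ : ℝ => Complex.exp (Complex.I * ξ * x) *
      (Complex.exp (-(∫ τ in s..t', Complex.log (1 + (b τ : ℂ) * ψ ξ))) * g ξ)) := fun t' => by
    refine AEStronglyMeasurable.mul (by fun_prop) (AEStronglyMeasurable.mul ?_ hgm)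
    exact (Complex.continuous_exp.comp_stronglyMeasurable
      (stronglyMeasurable_intervalIntegral_log hb hψ s t').neg).aestronglyMeasurable
  have hpoly : ∀ c₀ c₁ : ℝ, Integrable fun ξ : ℝ =>
      (c₀ + B * (1 + ξ ^ 2)) * ((c₁ + B * (1 + ξ ^ 2)) * ‖g ξ‖) := fun c₀ c₁ => by
    have h := (((hg 0).const_mul ((c₀ + B) * (c₁ + B))).add
      ((hg 2).const_mul (B * (c₀ + c₁ + 2 * B)))).add ((hg 4).const_mul (B * B))
    refine h.congr (Eventually.of_forall fun ξ => ?_)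
    have h4 : |ξ| ^ 4 = ξ ^ 4 := by
      rw [show 4 = 2 * 2 from rfl, pow_mul, sq_abs, pow_mul]
    simp only [Pi.add_apply, Real.norm_eq_abs, sq_abs, h4, pow_zero]
    ring
  have hF : Integrable (fun ξ : ℝ => Complex.exp (Complex.I * ξ * x) *
      (Complex.exp (-(∫ τ in s..t, Complex.log (1 + (b τ : ℂ) * ψ ξ))) * g ξ)) := by
    refine (hpoly 1 1).mono' (hmeas t) (Eventually.of_forall fun ξ => ?_)
    rw [norm_mul, hx, one_mul, norm_mul]
    have h1 : 0 ≤ B * (1 + ξ ^ 2) := by positivity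
    calc _ ≤ (1 + B * (1 + ξ ^ 2)) * ‖g ξ‖ := by
          gcongr
          exact hexp t ht ξ
      _ ≤ _ := le_mul_of_one_le_left (by positivity) (by linarith)
  refine (hasDerivAt_integral_of_dominated_loc_of_deriv_le (𝕜 := ℝ)
    (F := fun (t' : ℝ) (ξ : ℝ) => Complex.exp (Complex.I * ξ * x) *
        (Complex.exp (-(∫ τ in s..t', Complex.log (1 + (b τ : ℂ) * ψ ξ))) * g ξ))
    (F' := fun (t' : ℝ) (ξ : ℝ) => Complex.exp (Complex.I * ξ * x) *
        ((-Complex.log (1 + (b t' : ℂ) * ψ ξ)) *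
          (Complex.exp (-(∫ τ in s..t', Complex.log (1 + (b τ : ℂ) * ψ ξ))) * g ξ)))
    (Ioo_mem_nhds ht.1 ht.2) (Eventually.of_forall hmeas) hF ?_
    (Eventually.of_forall fun ξ t' ht' => ?_) (hpoly Real.pi 1)
    (Eventually.of_forall fun ξ t' ht' => ?_)).2
  · refine AEStronglyMeasurable.congr (f := fun ξ : ℝ => (-Complex.log (1 + (b t : ℂ) * ψ ξ)) *
      (Complex.exp (Complex.I * ξ * x) *
      (Complex.exp (-(∫ τ in s..t, Complex.log (1 + (b τ : ℂ) * ψ ξ))) * g ξ))) ?_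
      (Eventually.of_forall fun ξ => mul_left_comm _ _ _)
    refine AEStronglyMeasurable.mul (Measurable.aestronglyMeasurable ?_) (hmeas t)
    exact (Complex.measurable_log.comp (by fun_prop)).neg
  · have hbt := hab t' (Set.Ioo_subset_Icc_self ht')
    have h1 : 0 ≤ B * (1 + ξ ^ 2) := by positivity
    rw [norm_mul, hx, one_mul, norm_mul, norm_neg, norm_mul]
    gcongr
    · exact (norm_log_one_add_mul_le (hre ξ) hbt.1 hbt.2 (hgrowth ξ)).1
    · exact hexp t' ht' ξ
  · have hbt := hab t' (Set.Ioo_subset_Icc_self ht')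
    have hd := intervalIntegral.integral_hasDerivAt_right
      (intervalIntegrable_log_one_add_mul hb (hre ξ) fun τ hτ => (hsub t' ht' τ hτ).1)
      (Measurable.stronglyMeasurable (Complex.measurable_log.comp
        (by have := hb.measurable; fun_prop))).stronglyMeasurableAtFilter
      (continuousAt_log_one_add_mul hb (hre ξ) hbt.1)
    convert! ((hd.neg.cexp).mul_const (g ξ)).const_mul (Complex.exp (Complex.I * ξ * x)) using 1
    rw [Pi.neg_apply]
    ring

theorem feller_re_nonneg {α θ : ℝ} (hθ : |θ| ≤ 1) (ξ : ℝ) : 0 ≤ (feller α θ ξ).re := by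
  unfold feller
  rw [Complex.re_ofReal_mul]
  refine mul_nonneg (by positivity) ?_
  have harg : Complex.I * Real.sign ξ * θ * Real.pi / 2 =
      ((Real.sign ξ * θ * Real.pi / 2 : ℝ) : ℂ) * Complex.I := by
    push_cast; ring
  rw [harg, Complex.exp_ofReal_mul_I_re]
  obtain ⟨h1, h2⟩ := abs_le.mp hθ
  apply Real.cos_nonneg_of_mem_Icc
  rcases Real.sign_apply_eq ξ with h | h | h <;> rw [h] <;> constructor <;>
    nlinarith [Real.pi_pos]

theorem norm_feller_le {α : ℝ} (hα : α ∈ Set.Ioc (0 : ℝ) 2) (θ ξ : ℝ) :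
    ‖feller α θ ξ‖ ≤ 1 + ξ ^ 2 := by
  unfold feller
  have harg : Complex.I * Real.sign ξ * θ * Real.pi / 2 =
      ((Real.sign ξ * θ * Real.pi / 2 : ℝ) : ℂ) * Complex.I := by
    push_cast; ring
  rw [harg, norm_mul, Complex.norm_exp_ofReal_mul_I, mul_one, Complex.norm_real,
    Real.norm_of_nonneg (by positivity)]
  rcases le_total |ξ| 1 with h | h
  · have := Real.rpow_le_one (abs_nonneg ξ) h hα.1.le
    nlinarith [sq_nonneg ξ]
  · have := Real.rpow_le_rpow_of_exponent_le h hα.2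
    rw [Real.rpow_two, sq_abs] at this
    linarith

theorem measurable_feller (α θ : ℝ) : Measurable (feller α θ) := by
  have hsign : Measurable Real.sign :=
    Measurable.ite measurableSet_Iio measurable_const
      (Measurable.ite measurableSet_Ioi measurable_const measurable_const)
  unfold feller
  fun_prop

open scoped FourierTransform in
theorem fhat_eq_fourier (f : SchwartzMap ℝ ℂ) (p : ℝ) :
    fhat f p = (Real.sqrt (2 * Real.pi))⁻¹ * (𝓕 f : SchwartzMap ℝ ℂ) (p / (2 * Real.pi)) := by
  rw [SchwartzMap.fourier_coe, Real.fourier_real_eq_integral_exp_smul, fhat]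
  congr 2
  ext x
  rw [smul_eq_mul]
  congr 2
  have : (Real.pi : ℂ) ≠ 0 := by exact_mod_cast Real.pi_ne_zero
  push_cast
  field_simp

open scoped FourierTransform in
theorem integrable_pow_mul_fhat (f : SchwartzMap ℝ ℂ) (k : ℕ) :
    Integrable fun ξ : ℝ => ‖ξ‖ ^ k * ‖fhat f ξ‖ := by
  have h := (((𝓕 f : SchwartzMap ℝ ℂ).integrable_pow_mul volume k).comp_div
    (Real.two_pi_pos.ne')).const_mul ((2 * Real.pi) ^ k * ‖(Real.sqrt (2 * Real.pi))⁻¹‖)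
  refine h.congr (Eventually.of_forall fun ξ => ?_)
  have hp : (2 * Real.pi) ^ k ≠ 0 := pow_ne_zero _ Real.two_pi_pos.ne'
  simp only [fhat_eq_fourier, norm_mul, norm_div, div_pow,
    Complex.norm_real, Real.norm_of_nonneg Real.pi_pos.le, Real.norm_ofNat]
  field_simp

theorem continuous_fhat (f : SchwartzMap ℝ ℂ) : Continuous (fhat f) := by
  simp only [funext (fhat_eq_fourier f)]
  fun_prop

open scoped FourierTransform in
theorem integral_exp_mul_fhat (f : SchwartzMap ℝ ℂ) (x : ℝ) :
    (Real.sqrt (2 * Real.pi))⁻¹ * ∫ ξ : ℝ, Complex.exp (Complex.I * ξ * x) * fhat f ξ =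
      f x := by
  have hpi : (Real.pi : ℂ) ≠ 0 := by exact_mod_cast Real.pi_ne_zero
  have hinv : 𝓕⁻ (⇑(𝓕 f : SchwartzMap ℝ ℂ)) x = f x := by
    rw [← SchwartzMap.fourierInv_coe]; simp
  rw [Real.fourierInv_eq'] at hinv
  have hcomp := Measure.integral_comp_div (fun v : ℝ =>
    Complex.exp (↑(2 * Real.pi * inner ℝ v x) * Complex.I) • (𝓕 f : SchwartzMap ℝ ℂ) v)
    (2 * Real.pi)
  rw [hinv, abs_of_pos Real.two_pi_pos] at hcomp
  have hint : ∫ ξ : ℝ, Complex.exp (Complex.I * ξ * x) * fhat f ξ =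
      (Real.sqrt (2 * Real.pi))⁻¹ * ((2 * Real.pi : ℝ) • f x) := by
    rw [← hcomp, ← integral_const_mul]
    congr 1
    ext ξ
    rw [fhat_eq_fourier, smul_eq_mul, mul_left_comm]
    congr 3
    simp only [RCLike.inner_apply, conj_trivial]
    push_cast
    field_simp
  rw [hint, Complex.real_smul, ← mul_assoc, ← mul_assoc,
    ← Complex.ofReal_mul, ← Complex.ofReal_mul, ← mul_inv,
    Real.mul_self_sqrt Real.two_pi_pos.le, inv_mul_cancel₀ Real.two_pi_pos.ne',
    Complex.ofReal_one, one_mul]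

theorem stmt15
    (α θ : ℝ) (hα : α ∈ Set.Ioc (0 : ℝ) 2) (hα1 : α ≠ 1)
    (hθ : |θ| ≤ min α (2 - α))
    (b : ℝ → ℝ) (hbc : Continuous b) (hbpos : ∀ t : ℝ, 0 ≤ t → 0 < b t)
    (s : ℝ) (hs : 0 ≤ s) (f : SchwartzMap ℝ ℂ)
    (u : ℝ → ℝ → ℂ)
    (hu : ∀ x t : ℝ, u x t = (Real.sqrt (2 * Real.pi))⁻¹ *
      ∫ ξ : ℝ, Complex.exp (Complex.I * ξ * x) *
        (Complex.exp (-(∫ τ in s..t,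
            Complex.log (1 + (b τ : ℂ) * feller α θ ξ))) * fhat (⇑f) ξ)) :
    (∀ x : ℝ, u x s = f x) ∧
    (∀ x t : ℝ, s ≤ t →
      HasDerivAt (fun t' : ℝ => u x t')
        ((Real.sqrt (2 * Real.pi))⁻¹ *
          ∫ ξ : ℝ, Complex.exp (Complex.I * ξ * x) *
            ((-Complex.log (1 + (b t : ℂ) * feller α θ ξ)) *
              (Complex.exp (-(∫ τ in s..t,
                  Complex.log (1 + (b τ : ℂ) * feller α θ ξ))) * fhat (⇑f) ξ)))
        t) := by
  refine ⟨fun x => ?_, fun x t hst => ?_⟩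
  · rw [hu]
    simpa using integral_exp_mul_fhat f x
  · have hθ1 : |θ| ≤ 1 := by
      have h1 := hθ.trans (min_le_left _ _)
      have h2 := hθ.trans (min_le_right _ _)
      linarith
    obtain ⟨δ, hδ, hball⟩ := Metric.eventually_nhds_iff.mp
      (hbc.continuousAt.eventually_const_lt (hbpos 0 le_rfl))
    have hmin : 0 < min 1 (δ / 2) := by positivity
    have hmin1 : min 1 (δ / 2) ≤ 1 := min_le_left _ _
    have hmin2 : min 1 (δ / 2) ≤ δ / 2 := min_le_right _ _
    obtain ⟨B, hB⟩ := (isCompact_Icc (a := s - min 1 (δ / 2)) (b := t + 1)).bddAbove_image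
      hbc.continuousOn
    have hpos : ∀ τ ∈ Set.Icc (s - min 1 (δ / 2)) (t + 1), 0 < b τ ∧ b τ ≤ B := fun τ hτ => by
      refine ⟨?_, hB ⟨τ, hτ, rfl⟩⟩
      rcases le_or_gt 0 τ with h | h
      · exact hbpos τ h
      · refine hball ?_
        rw [Real.dist_eq, sub_zero, abs_of_neg h]
        linarith [hτ.1]
    simp only [hu]
    exact (hasDerivAt_integral_exp_neg_integral_log hbc (measurable_feller α θ)
      (feller_re_nonneg hθ1) (norm_feller_le hα θ) (integrable_pow_mul_fhat f)
      (continuous_fhat f).aestronglyMeasurable hpos ⟨by linarith, by linarith⟩ (by linarith)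
      ⟨by linarith, by linarith⟩ x).const_mul _
end
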